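/- Fix integers m ≥ 2 and k ≥ 3, and let i be a positive divisor of m. Then r_ℳ(i mod m, m, k) = Σ_{l ∣ i, l ≥ 1} l·φ(m/l)·r_ℳ(l mod m, m, k−1), where φ denotes Euler's totient function and the sum is over the positive divisors l of i. -/

import Mathlib

/-- `pM m k n` is the number of restricted `m`-ary partitions of `n` with parts
`1, m, m^2, …, m^(k-1)`. -/
noncomputable def pM (m k n : ℕ) : ℕ :=
  Nat.card {x : Fin k → ℕ // ∑ i : Fin k, x i * m ^ (i : ℕ) = n}

/-- `rM i m k = #{n ∈ {0,…,m^k - 1} : p_ℳ(n,k) ≡ i (mod m)}`. -/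
noncomputable def rM (i m k : ℕ) : ℕ :=
  ((Finset.range (m ^ k)).filter (fun n : ℕ => pM m k n % m = i)).card

/-- Splitting off the number of parts equal to `1`. -/
def partitionEquiv (m k n : ℕ) (hm : 0 < m) :
    {x : Fin (k + 1) → ℕ // ∑ i, x i * m ^ (i : ℕ) = n} ≃
      Σ j : Fin (n / m + 1), {y : Fin k → ℕ // ∑ i, y i * m ^ (i : ℕ) = j} where
  toFun x := ⟨⟨∑ i : Fin k, x.1 i.succ * m ^ (i : ℕ), by
    have h := x.2
    simp only [Fin.sum_univ_succ, Fin.val_zero, Fin.val_succ, pow_succ, ← mul_assoc,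
      ← Finset.sum_mul] at h
    rw [Nat.lt_succ_iff, Nat.le_div_iff_mul_le hm]
    omega⟩, fun i ↦ x.1 i.succ, rfl⟩
  invFun y := ⟨Fin.cons (n - m * y.1) y.2.1, by
    have h : (y.1 : ℕ) * m ≤ n := (Nat.le_div_iff_mul_le hm).1 (Nat.lt_succ_iff.1 y.1.2)
    simp only [Fin.sum_univ_succ, Fin.val_zero, Fin.val_succ, pow_succ, ← mul_assoc,
      ← Finset.sum_mul, Fin.cons_zero, Fin.cons_succ, y.2.2]
    rw [mul_comm] at h ⊢
    rw [mul_comm (y.1 : ℕ)]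
    simp
    omega⟩
  left_inv x := by
    obtain ⟨x, rfl⟩ := x
    ext i
    refine Fin.cases ?_ (fun i ↦ ?_) i
    · simp only [Fin.cons_zero, Fin.sum_univ_succ, Fin.val_zero, Fin.val_succ, pow_succ,
        ← mul_assoc, ← Finset.sum_mul]
      rw [mul_comm m]
      simp
    · simp
  right_inv y := by
    obtain ⟨⟨j, hj⟩, y, hy⟩ := y
    dsimp only at hy
    subst hy
    rfl

instance finite_partitions (m k n : ℕ) [NeZero m] :
    Finite {x : Fin k → ℕ // ∑ i, x i * m ^ (i : ℕ) = n} := by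
  induction k generalizing n with
  | zero => infer_instance
  | succ k ih => exact Finite.of_equiv _ (partitionEquiv m k n (NeZero.pos m)).symm

theorem pM_succ (m k n : ℕ) [NeZero m] :
    pM m (k + 1) n = ∑ j ∈ Finset.range (n / m + 1), pM m k j := by
  rw [pM, Nat.card_congr (partitionEquiv m k n (NeZero.pos m)), Nat.card_sigma,
    ← Fin.sum_univ_eq_sum_range]
  rfl

theorem sum_range_mul_block {M : Type*} [AddCommMonoid M] (m a : ℕ) (g : ℕ → M) :
    ∑ n ∈ Finset.range (m * a), g n
      = ∑ q ∈ Finset.range a, ∑ d ∈ Finset.range m, g (m * q + d) := by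
  induction a with
  | zero => simp
  | succ a ih => rw [mul_add_one, Finset.sum_range_add, ih, Finset.sum_range_succ]

theorem pM_block (m k q d : ℕ) [NeZero m] (hd : d < m) :
    pM m (k + 1) (m * q + d) = pM m (k + 1) (m * q) := by
  rw [pM_succ, pM_succ, Nat.mul_add_div (NeZero.pos m), Nat.div_eq_of_lt hd,
    Nat.mul_div_cancel_left _ (NeZero.pos m), add_zero]

theorem pM_add_two_cast (m k t d e : ℕ) [NeZero m] (hd : d < m) (he : e < m) :
    (pM m (k + 2) (m * (m * t + d) + e) : ZMod m) = (d + 1) * pM m (k + 1) (m * t) := by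
  rw [pM_block _ _ _ _ he, pM_succ, Nat.mul_div_cancel_left _ (NeZero.pos m), add_assoc,
    Finset.sum_range_add, sum_range_mul_block]
  push_cast
  rw [Finset.sum_eq_zero, zero_add,
    Finset.sum_congr rfl (g := fun _ ↦ (pM m (k + 1) (m * t) : ZMod m))]
  · simp
  · intro x hx
    rw [pM_block _ _ _ _ (by grind)]
  · intro q _
    rw [Finset.sum_congr rfl (g := fun _ ↦ (pM m (k + 1) (m * q) : ZMod m))]
    · simp
    · intro x hx
      rw [pM_block _ _ _ _ (by grind)]

/-- The number of `a` with `a * x = c` in `ZMod m`. -/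
def mulFiber (m : ℕ) [NeZero m] (x c : ZMod m) : ℕ :=
  ∑ a : ZMod m, if a * x = c then 1 else 0

theorem sum_range_eq_sum_zmod {M : Type*} [AddCommMonoid M] (m : ℕ) [NeZero m]
    (g : ZMod m → M) : ∑ d ∈ Finset.range m, g d = ∑ a : ZMod m, g a := by
  refine Finset.sum_bij' (fun d _ ↦ (d : ZMod m)) (fun a _ ↦ a.val) ?_ ?_ ?_ ?_ ?_
  · simp
  · intro a _
    simpa using ZMod.val_lt a
  · intro d hd
    exact ZMod.val_cast_of_lt (by simpa using hd)
  · simp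
  · simp

theorem sum_range_succ_mul_eq (m : ℕ) [NeZero m] (x c : ZMod m) :
    (∑ d ∈ Finset.range m, if ((d : ZMod m) + 1) * x = c then 1 else 0) = mulFiber m x c := by
  rw [sum_range_eq_sum_zmod m (fun a ↦ if (a + 1) * x = c then 1 else 0), mulFiber]
  exact Fintype.sum_equiv (Equiv.addRight 1) _ _ (fun _ ↦ rfl)

/-- The number of `n < m ^ k` whose number of partitions has residue class `c`. -/
noncomputable def residueCount (m k : ℕ) (c : ZMod m) : ℕ :=
  ∑ n ∈ Finset.range (m ^ k), if (pM m k n : ZMod m) = c then 1 else 0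

theorem rM_mod (i m k : ℕ) : rM (i % m) m k = residueCount m k i := by
  rw [rM, residueCount, Finset.card_filter]
  simp only [ZMod.natCast_eq_natCast_iff, Nat.ModEq]

theorem residueCount_add_two_eq_sum_range (m k : ℕ) [NeZero m] (c : ZMod m) :
    residueCount m (k + 2) c
      = ∑ n ∈ Finset.range (m ^ (k + 1)), mulFiber m (pM m (k + 1) n) c := by
  rw [residueCount, pow_succ', pow_succ', sum_range_mul_block, sum_range_mul_block,
    sum_range_mul_block]
  refine Finset.sum_congr rfl fun t _ ↦ ?_
  have hl : ∀ d ∈ Finset.range m, (∑ e ∈ Finset.range m,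
      if (pM m (k + 2) (m * (m * t + d) + e) : ZMod m) = c then 1 else 0)
      = m * if ((d : ZMod m) + 1) * pM m (k + 1) (m * t) = c then 1 else 0 := by
    intro d hd
    rw [Finset.sum_congr rfl fun e he ↦ by
      rw [pM_add_two_cast m k t d e (by simpa using hd) (by simpa using he)]]
    simp
  have hr : ∀ d ∈ Finset.range m, mulFiber m (pM m (k + 1) (m * t + d)) c
      = mulFiber m (pM m (k + 1) (m * t)) c := fun d hd ↦ by
    rw [pM_block _ _ _ _ (by simpa using hd)]
  rw [Finset.sum_congr rfl hl, Finset.sum_congr rfl hr, ← Finset.mul_sum, sum_range_succ_mul_eq]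
  simp

theorem residueCount_add_two (m k : ℕ) [NeZero m] (c : ZMod m) :
    residueCount m (k + 2) c = ∑ b, residueCount m (k + 1) b * mulFiber m b c := by
  rw [residueCount_add_two_eq_sum_range]
  simp only [residueCount, Finset.sum_mul]
  rw [Finset.sum_comm]
  simp

theorem mulFiber_unit_mul_left (m : ℕ) [NeZero m] (u : (ZMod m)ˣ) (x c : ZMod m) :
    mulFiber m (u * x) c = mulFiber m x c :=
  Fintype.sum_equiv (Units.mulRight u) _ _ fun a ↦ by simp [mul_assoc]

theorem mulFiber_unit_mul_right (m : ℕ) [NeZero m] (u : (ZMod m)ˣ) (x c : ZMod m) :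
    mulFiber m x (u * c) = mulFiber m x c :=
  (Fintype.sum_equiv (Units.mulLeft u) _ _ fun a ↦ by simp [mul_assoc]).symm

theorem residueCount_unit_mul (m k : ℕ) [NeZero m] (u : (ZMod m)ˣ) (c : ZMod m) :
    residueCount m (k + 2) (u * c) = residueCount m (k + 2) c := by
  simp only [residueCount_add_two, mulFiber_unit_mul_right]

theorem exists_unit_mul_gcd (m : ℕ) [NeZero m] (b : ℕ) :
    ∃ u : (ZMod m)ˣ, (b : ZMod m) = u * (m.gcd b : ℕ) := by
  obtain ⟨d, hd, u, hu, h⟩ := ZMod.eq_unit_mul_divisor (b : ZMod m)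
  obtain ⟨u, rfl⟩ := hu
  have hb : b ≡ (u : ZMod m).val * d [MOD m] := by
    rw [← ZMod.natCast_eq_natCast_iff]
    simpa using h
  have hg : m.gcd b = d := by
    rw [Nat.gcd_comm, hb.gcd_eq, Nat.Coprime.gcd_mul_left_cancel _ (ZMod.val_coe_unit_coprime u),
      Nat.gcd_eq_left hd]
  exact ⟨u, by rw [hg, h]⟩

theorem mulFiber_divisor (m l i : ℕ) [NeZero m] (hl : l ∣ m) :
    mulFiber m l i = if l ∣ i then l else 0 := by
  rw [mulFiber, ← sum_range_eq_sum_zmod m (fun a ↦ if a * (l : ZMod m) = i then 1 else 0),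
    ← Finset.card_filter]
  have hm := NeZero.pos m
  split_ifs with h
  · obtain ⟨v, rfl⟩ := h
    obtain ⟨r, rfl⟩ := hl
    have hl0 : 0 < l := Nat.pos_of_mul_pos_right hm
    have hr0 : 0 < r := Nat.pos_of_mul_pos_left hm
    have key : ∀ a : ℕ, (a : ZMod (l * r)) * l = (l * v : ℕ) ↔ a ≡ v [MOD r] := fun a ↦ by
      rw [← Nat.cast_mul, ZMod.natCast_eq_natCast_iff, mul_comm a,
        Nat.ModEq.mul_left_cancel_iff' hl0.ne']
    simp only [key]
    rw [← Nat.count_eq_card_filter_range, Nat.count_modEq_card _ hr0]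
    simp [hr0]
  · rw [Finset.card_eq_zero, Finset.filter_eq_empty_iff]
    intro a _ ha
    rw [← Nat.cast_mul, ZMod.natCast_eq_natCast_iff] at ha
    exact h ((ha.dvd_iff hl).1 (dvd_mul_left _ _))

theorem stmt_15 (m k : ℕ) (hm : 2 ≤ m) (hk : 3 ≤ k) (i : ℕ) (hi : 0 < i)
    (him : i ∣ m) :
    rM (i % m) m k = ∑ l ∈ i.divisors, l * Nat.totient (m / l) * rM (l % m) m (k - 1) := by
  have : NeZero m := ⟨by omega⟩
  obtain ⟨k, rfl⟩ := Nat.exists_eq_add_of_le' hk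
  simp only [rM_mod, show k + 3 - 1 = k + 2 from rfl]
  rw [show k + 3 = k + 1 + 2 from rfl, residueCount_add_two,
    ← sum_range_eq_sum_zmod m (fun b ↦ residueCount m (k + 2) b * mulFiber m b i)]
  have hterm : ∀ b : ℕ, residueCount m (k + 2) b * mulFiber m b i
      = residueCount m (k + 2) (m.gcd b : ℕ) * if m.gcd b ∣ i then m.gcd b else 0 := by
    intro b
    obtain ⟨u, hu⟩ := exists_unit_mul_gcd m b
    rw [hu, residueCount_unit_mul, mulFiber_unit_mul_left,
      mulFiber_divisor m _ i (Nat.gcd_dvd_left m b)]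
  simp only [hterm]
  rw [← Finset.sum_fiberwise_of_maps_to (t := m.divisors) (g := fun b ↦ m.gcd b)
    (fun b _ ↦ Nat.mem_divisors.2 ⟨Nat.gcd_dvd_left m b, NeZero.ne m⟩),
    ← Finset.sum_subset (Nat.divisors_subset_of_dvd (NeZero.ne m) him)]
  · refine Finset.sum_congr rfl fun l hl ↦ ?_
    have hli := Nat.dvd_of_mem_divisors hl
    rw [Nat.totient_div_of_dvd (hli.trans him), Finset.card_eq_sum_ones, Finset.mul_sum,
      Finset.sum_mul]
    refine Finset.sum_congr rfl fun b hb ↦ ?_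
    rw [(Finset.mem_filter.1 hb).2, if_pos hli]
    ring
  · intro l _ hl
    refine Finset.sum_eq_zero fun b hb ↦ ?_
    rw [(Finset.mem_filter.1 hb).2, if_neg fun h ↦ hl (Nat.mem_divisors.2 ⟨h, hi.ne'⟩), mul_zero]
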